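/- Let N = 2^n with n ≥ 2, let F_N be the N×N DFT matrix, let R be the N×(N/2) reflection matrix and R̃ = R/√2 its normalisation. Let D be an invertible real diagonal (N/2)×(N/2) matrix with diagonal entries d_0, …, d_{N/2−1}, and let D_E be any invertible real diagonal N×N matrix with (D_E)_{kk} = (D_E)_{N−k,N−k} = d_k for 1 ≤ k ≤ N/2−1. Then for every f ∈ ℂ^{N/2} with f_0 = 0, the vector R̃ᵀ F_N† R̃ D^{−1} R̃ᵀ F_N R̃ f equals the restriction to the first N/2 components of the extended-domain solution u_E = F_N† D_E^{−1} F_N R f. In other words, the half-size sine-transform solution formula reproduces the first half of the full-size Fourier solution formula. -/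

import Mathlib

open Matrix

/-- The `N`-th root of unity `ω_N = exp(2πi/N)`. -/
noncomputable def omegaN (N : ℕ) : ℂ := Complex.exp (2 * Real.pi * Complex.I / N)

/-- The `N × N` discrete Fourier transform matrix with entries `(F_N)_{jk} = ω_N^{jk} / √N`. -/
noncomputable def Fmat (N : ℕ) : Matrix (Fin N) (Fin N) ℂ :=
  fun j k => omegaN N ^ (j.val * k.val) / (Real.sqrt N : ℂ)

/-- The `N × (N/2)` reflection matrix for `N = 2^n`: `R_{k,k} = 1` and `R_{N−k,k} = −1` for
`1 ≤ k ≤ N/2 − 1`, all other entries zero. -/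
noncomputable def Rmat (n : ℕ) : Matrix (Fin (2 ^ n)) (Fin (2 ^ (n - 1))) ℂ :=
  fun j k =>
    if k.val ≠ 0 ∧ j.val = k.val then 1
    else if k.val ≠ 0 ∧ j.val = 2 ^ n - k.val then -1
    else 0

/-- The normalised reflection matrix `R̃ = R / √2`. -/
noncomputable def Rtil (n : ℕ) : Matrix (Fin (2 ^ n)) (Fin (2 ^ (n - 1))) ℂ :=
  (1 / (Real.sqrt 2 : ℂ)) • Rmat n

/-- A vector indexed by `Fin N` is odd if it changes sign under negation modulo `N`. -/
def IsOddVec {N : ℕ} [NeZero N] (x : Fin N → ℂ) : Prop := ∀ j, x (-j) = -x j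

theorem IsOddVec.mulVec {N : ℕ} [NeZero N] {x : Fin N → ℂ} (hx : IsOddVec x)
    {M : Matrix (Fin N) (Fin N) ℂ} (hM : ∀ j k, M (-j) k = M j (-k)) : IsOddVec (M *ᵥ x) := by
  intro j
  simp only [Matrix.mulVec, dotProduct, hM]
  rw [← Equiv.sum_comp (Equiv.neg (Fin N)), ← Finset.sum_neg_distrib]
  refine Finset.sum_congr rfl fun k _ => ?_
  simp [hx k]

theorem omegaN_pow_self {N : ℕ} [NeZero N] : omegaN N ^ N = 1 :=
  (Complex.isPrimitiveRoot_exp N (NeZero.ne N)).pow_eq_one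

theorem dvd_val_neg_add_val {N : ℕ} [NeZero N] (j : Fin N) : N ∣ (-j).val + j.val := by
  have h : ((-j + j : Fin N)).val = 0 := by simp
  rw [Fin.val_add] at h
  exact Nat.dvd_of_mod_eq_zero h

theorem omegaN_pow_neg_mul {N : ℕ} [NeZero N] (j k : Fin N) :
    omegaN N ^ ((-j).val * k.val) = (omegaN N ^ (j.val * k.val))⁻¹ := by
  apply eq_inv_of_mul_eq_one_left
  rw [← pow_add, ← add_mul]
  obtain ⟨c, hc⟩ := dvd_val_neg_add_val j
  rw [hc, mul_assoc, pow_mul, omegaN_pow_self, one_pow]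

theorem Fmat_comm {N : ℕ} (j k : Fin N) : Fmat N j k = Fmat N k j := by
  simp [Fmat, mul_comm]

theorem Fmat_neg {N : ℕ} [NeZero N] (j k : Fin N) : Fmat N (-j) k = Fmat N j (-k) := by
  rw [Fmat_comm j (-k)]
  simp only [Fmat]
  rw [omegaN_pow_neg_mul, omegaN_pow_neg_mul, mul_comm j.val]

theorem conjTranspose_Fmat_neg {N : ℕ} [NeZero N] (j k : Fin N) :
    (Fmat N)ᴴ (-j) k = (Fmat N)ᴴ j (-k) := by
  rw [Matrix.conjTranspose_apply, Matrix.conjTranspose_apply, Fmat_neg]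

/-- The inclusion of the first half of the indices. -/
def halfIncl (n : ℕ) (k : Fin (2 ^ (n - 1))) : Fin (2 ^ n) :=
  Fin.castLE (Nat.pow_le_pow_right (by norm_num) (Nat.sub_le n 1)) k

theorem val_halfIncl {n : ℕ} (k : Fin (2 ^ (n - 1))) : (halfIncl n k).val = k.val := rfl

theorem halfIncl_injective (n : ℕ) : Function.Injective (halfIncl n) :=
  Fin.castLE_injective (Nat.pow_le_pow_right (by norm_num) (Nat.sub_le n 1))

theorem val_neg_eq_ite {N : ℕ} [NeZero N] (j : Fin N) :
    (-j).val = if j.val = 0 then 0 else N - j.val := by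
  rw [Fin.val_neg']
  have := j.isLt
  split_ifs with h
  · simp [h]
  · exact Nat.mod_eq_of_lt (by omega)

theorem two_pow_eq_two_mul {n : ℕ} (hn : 1 ≤ n) : 2 ^ n = 2 * 2 ^ (n - 1) := by
  rw [← pow_succ', Nat.sub_add_cancel hn]

theorem Rmat_apply {n : ℕ} (hn : 1 ≤ n) (j : Fin (2 ^ n)) (k : Fin (2 ^ (n - 1))) :
    Rmat n j k = (if j = halfIncl n k then 1 else 0) - (if j = -halfIncl n k then 1 else 0) := by
  have hN := two_pow_eq_two_mul hn
  have hk := k.isLt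
  simp only [Rmat, Fin.ext_iff, val_neg_eq_ite, val_halfIncl]
  by_cases hk0 : k.val = 0
  · simp [hk0]
  · simp only [hk0, ne_eq, not_false_eq_true, true_and, if_false]
    by_cases h1 : j.val = k.val
    · have h2 : ¬ j.val = 2 ^ n - k.val := by omega
      rw [if_pos h1, if_pos h1, if_neg h2, sub_zero]
    · simp only [h1, if_false]
      split_ifs <;> simp

theorem isOddVec_Rmat_mulVec {n : ℕ} (hn : 1 ≤ n) (g : Fin (2 ^ (n - 1)) → ℂ) :
    IsOddVec (Rmat n *ᵥ g) := by
  intro j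
  simp only [Matrix.mulVec, dotProduct, ← Finset.sum_neg_distrib]
  refine Finset.sum_congr rfl fun k _ => ?_
  simp only [Rmat_apply hn, neg_eq_iff_eq_neg, neg_neg]
  ring

theorem IsOddVec.transpose_Rmat_mulVec {n : ℕ} (hn : 1 ≤ n) {x : Fin (2 ^ n) → ℂ}
    (hx : IsOddVec x) (k : Fin (2 ^ (n - 1))) :
    ((Rmat n)ᵀ *ᵥ x) k = 2 * x (halfIncl n k) := by
  simp only [Matrix.mulVec, dotProduct, Matrix.transpose_apply, Rmat_apply hn, sub_mul, ite_mul,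
    one_mul, zero_mul, Finset.sum_sub_distrib, Finset.sum_ite_eq', Finset.mem_univ, if_true, hx _]
  ring

theorem IsOddVec.apply_eq_zero {N : ℕ} [NeZero N] {x : Fin N → ℂ} (hx : IsOddVec x)
    {j : Fin N} (hj : -j = j) : x j = 0 := by
  have h := hx j
  rw [hj] at h
  exact self_eq_neg.mp h

theorem Rmat_mulVec_halfIncl {n : ℕ} (hn : 1 ≤ n) (g : Fin (2 ^ (n - 1)) → ℂ)
    (hg : ∀ k : Fin (2 ^ (n - 1)), k.val = 0 → g k = 0) (k : Fin (2 ^ (n - 1))) :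
    (Rmat n *ᵥ g) (halfIncl n k) = g k := by
  have hN := two_pow_eq_two_mul hn
  simp only [Matrix.mulVec, dotProduct, Rmat_apply hn, sub_mul, Finset.sum_sub_distrib,
    (halfIncl_injective n).eq_iff, ite_mul, one_mul, zero_mul, Finset.sum_ite_eq,
    Finset.mem_univ, if_true]
  rw [Finset.sum_eq_zero, sub_zero]
  intro i _
  split_ifs with h
  · apply hg
    have h' := congrArg Fin.val h
    rw [val_neg_eq_ite, val_halfIncl, val_halfIncl] at h'
    have := k.isLt
    have := i.isLt
    split_ifs at h' <;> omega
  · rfl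

theorem IsOddVec.ext_halfIncl {n : ℕ} (hn : 1 ≤ n) {x y : Fin (2 ^ n) → ℂ}
    (hx : IsOddVec x) (hy : IsOddVec y) (h : ∀ k, x (halfIncl n k) = y (halfIncl n k)) :
    x = y := by
  have hN := two_pow_eq_two_mul hn
  funext j
  have hj := j.isLt
  rcases lt_trichotomy j.val (2 ^ (n - 1)) with hlt | heq | hgt
  · exact h ⟨j.val, hlt⟩
  · have hneg : -j = j := by
      apply Fin.ext
      rw [val_neg_eq_ite]
      split_ifs <;> omega
    rw [hx.apply_eq_zero hneg, hy.apply_eq_zero hneg]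
  · have hjk : j = -halfIncl n ⟨2 ^ n - j.val, by omega⟩ := by
      apply Fin.ext
      rw [val_neg_eq_ite, val_halfIncl]
      split_ifs <;> simp only at * <;> omega
    rw [hjk, hx, hy, h]

theorem IsOddVec.Rmat_mulVec_transpose_Rmat_mulVec {n : ℕ} (hn : 1 ≤ n) {x : Fin (2 ^ n) → ℂ}
    (hx : IsOddVec x) : Rmat n *ᵥ ((Rmat n)ᵀ *ᵥ x) = (2 : ℂ) • x := by
  refine (isOddVec_Rmat_mulVec hn _).ext_halfIncl hn (fun j => by simp [hx j]) fun k => ?_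
  rw [Rmat_mulVec_halfIncl hn _ _ k, hx.transpose_Rmat_mulVec hn, Pi.smul_apply, smul_eq_mul]
  intro i hi
  rw [hx.transpose_Rmat_mulVec hn, hx.apply_eq_zero, mul_zero]
  apply Fin.ext
  rw [val_neg_eq_ite, val_halfIncl, if_pos hi, hi]

theorem inv_diagonal_of_ne_zero {ι : Type*} [Fintype ι] [DecidableEq ι] {v : ι → ℂ}
    (hv : ∀ i, v i ≠ 0) : (Matrix.diagonal v)⁻¹ = Matrix.diagonal fun i => (v i)⁻¹ := by
  apply Matrix.inv_eq_right_inv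
  rw [Matrix.diagonal_mul_diagonal, ← Matrix.diagonal_one]
  congr 1
  funext i
  exact mul_inv_cancel₀ (hv i)

theorem Rmat_mul_diagonal {n : ℕ} (a : Fin (2 ^ (n - 1)) → ℂ) (b : Fin (2 ^ n) → ℂ)
    (hab : ∀ (j : Fin (2 ^ n)) (k : Fin (2 ^ (n - 1))), k.val ≠ 0 →
      j.val = k.val ∨ j.val = 2 ^ n - k.val → b j = a k) :
    Rmat n * Matrix.diagonal a = Matrix.diagonal b * Rmat n := by
  ext j k
  rw [Matrix.mul_diagonal, Matrix.diagonal_mul]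
  simp only [Rmat]
  split_ifs with h1 h2
  · rw [hab j k h1.1 (Or.inl h1.2), mul_comm]
  · rw [hab j k h2.1 (Or.inr h2.2), mul_comm]
  · simp

theorem inv_sqrt_two_mul_self : (1 / (Real.sqrt 2 : ℂ)) * (1 / (Real.sqrt 2 : ℂ)) = 1 / 2 := by
  rw [div_mul_div_comm, one_mul, ← Complex.ofReal_mul, Real.mul_self_sqrt (by norm_num)]
  norm_num

/-- Let `N = 2^n`, `n ≥ 2`, let `D` be an invertible real diagonal `(N/2) × (N/2)` matrix
with diagonal entries `d_k` and `D_E` any invertible real diagonal `N × N` matrix with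
`(D_E)_{kk} = (D_E)_{N−k,N−k} = d_k` for `1 ≤ k ≤ N/2 − 1`.  Then for every `f ∈ ℂ^{N/2}`
with `f_0 = 0`, the half-size sine-transform solution `R̃ᵀ F_N† R̃ D⁻¹ R̃ᵀ F_N R̃ f` equals
the restriction to the first `N/2` components of the extended-domain solution
`u_E = F_N† D_E⁻¹ F_N R f`. -/
theorem half_size_solution_formula (n : ℕ) (hn : 2 ≤ n)
    (d : Fin (2 ^ (n - 1)) → ℝ) (hd : ∀ k, d k ≠ 0)
    (e : Fin (2 ^ n) → ℝ) (he : ∀ j, e j ≠ 0)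
    (hde : ∀ (j : Fin (2 ^ n)) (k : Fin (2 ^ (n - 1))), 1 ≤ k.val →
      (j.val = k.val → e j = d k) ∧ (j.val = 2 ^ n - k.val → e j = d k))
    (f : Fin (2 ^ (n - 1)) → ℂ)
    (hf0 : ∀ k : Fin (2 ^ (n - 1)), k.val = 0 → f k = 0) :
    ∀ (k : Fin (2 ^ (n - 1))) (j : Fin (2 ^ n)), j.val = k.val →
      ((Rtil n)ᵀ * (Fmat (2 ^ n))ᴴ * Rtil n *
        (Matrix.diagonal (fun k => (d k : ℂ)))⁻¹ *
        (Rtil n)ᵀ * Fmat (2 ^ n) * Rtil n).mulVec f k =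
      ((Fmat (2 ^ n))ᴴ * (Matrix.diagonal (fun j => (e j : ℂ)))⁻¹ *
        Fmat (2 ^ n) * Rmat n).mulVec f j := by
  intro k j hjk
  have hn1 : 1 ≤ n := by omega
  obtain rfl : j = halfIncl n k := Fin.ext hjk
  rw [inv_diagonal_of_ne_zero fun k => Complex.ofReal_ne_zero.mpr (hd k),
    inv_diagonal_of_ne_zero fun j => Complex.ofReal_ne_zero.mpr (he j)]
  have hcomm := Rmat_mul_diagonal (n := n) (fun k => (d k : ℂ)⁻¹) (fun j => (e j : ℂ)⁻¹) (by
    intro j k hk h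
    have := hde j k (Nat.one_le_iff_ne_zero.mpr hk)
    rcases h with h | h
    · rw [this.1 h]
    · rw [this.2 h])
  set A := Matrix.diagonal fun k => (d k : ℂ)⁻¹
  set B := Matrix.diagonal fun j => (e j : ℂ)⁻¹
  set y := Fmat (2 ^ n) *ᵥ (Rmat n *ᵥ f) with hy
  have hyodd : IsOddVec y := (isOddVec_Rmat_mulVec hn1 f).mulVec Fmat_neg
  have hscale : Rmat n *ᵥ (A *ᵥ ((Rmat n)ᵀ *ᵥ y)) = (2 : ℂ) • (B *ᵥ y) := by
    rw [Matrix.mulVec_mulVec, hcomm, ← Matrix.mulVec_mulVec,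
      hyodd.Rmat_mulVec_transpose_Rmat_mulVec hn1, Matrix.mulVec_smul]
  have hBodd : IsOddVec (B *ᵥ y) := by
    intro j
    have h := isOddVec_Rmat_mulVec hn1 (A *ᵥ ((Rmat n)ᵀ *ᵥ y)) j
    rw [hscale, Pi.smul_apply, Pi.smul_apply, ← smul_neg] at h
    exact smul_right_injective ℂ (two_ne_zero (α := ℂ)) h
  have hu := (hBodd.mulVec conjTranspose_Fmat_neg).transpose_Rmat_mulVec hn1 k
  simp only [Rtil, Matrix.transpose_smul, ← Matrix.mulVec_mulVec, Matrix.smul_mulVec,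
    Matrix.mulVec_smul, ← hy, hscale, smul_smul, Pi.smul_apply, hu, smul_eq_mul]
  linear_combination (4 * ((1 / (Real.sqrt 2 : ℂ)) * (1 / (Real.sqrt 2 : ℂ))) + 2) *
    ((Fmat (2 ^ n))ᴴ *ᵥ (B *ᵥ y)) (halfIncl n k) * inv_sqrt_two_mul_self
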